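/- arXiv:2204.02497 — 7 statements merged into one kernel-verified Lean document; each statement's English description precedes it below -/
import Mathlib

section
/- Let G be an m×n real matrix, M an n×m real matrix with M·G = I_n, and b ∈ ℝ^m with M·b = 0. Let g : ℝ^n → ℝ^n be any function, η ∈ ℝ, and define the target SGD step f : ℝ^m → ℝ^m by f(x) = x − η · G·(g(M·x)). Then for every w ∈ ℝ^n, f(G·w + b) = G·(w − η·g(w)) + b; that is, the target step applied to the encrypted parameter equals the encryption of the standard SGD step applied to the original parameter. -/
/-- the target SGD step applied to the encrypted parameter equals
the encryption of the standard SGD step applied to the original parameter. -/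
theorem target_step_commutes_with_immersion
    (m n : ℕ) (G : Matrix (Fin m) (Fin n) ℝ) (M : Matrix (Fin n) (Fin m) ℝ)
    (hMG : M * G = 1) (b : Fin m → ℝ) (hMb : M.mulVec b = 0)
    (g : (Fin n → ℝ) → (Fin n → ℝ)) (η : ℝ)
    (f : (Fin m → ℝ) → (Fin m → ℝ))
    (hf : ∀ x, f x = x - η • G.mulVec (g (M.mulVec x))) :
    ∀ w : Fin n → ℝ,
      f (G.mulVec w + b) = G.mulVec (w - η • g w) + b := by
  intro w
  have hM : M.mulVec (G.mulVec w + b) = w := by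
    rw [Matrix.mulVec_add, Matrix.mulVec_mulVec, hMG, hMb, Matrix.one_mulVec, add_zero]
  rw [hf, hM, Matrix.mulVec_sub, Matrix.mulVec_smul, sub_add_eq_add_sub]
end

section
/- Let G be an m×n real matrix, M an n×m real matrix with M·G = I_n, and b ∈ ℝ^m with M·b = 0. For each k ∈ ℕ let g_k : ℝ^n → ℝ^n be any function, and let η ∈ ℝ. Define sequences w_k ∈ ℝ^n and w̃_k ∈ ℝ^m by w_{k+1} = w_k − η·g_k(w_k), w̃_{k+1} = w̃_k − η·G·(g_k(M·w̃_k)), with initial conditions satisfying w̃_0 = G·w_0 + b. Then w̃_k = G·w_k + b for all k ∈ ℕ; i.e., the trajectory of the standard SGD is immersed in that of the target SGD via the affine immersion map. -/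
/-- the trajectory of the standard SGD is immersed in that of the
target SGD via the affine immersion map. -/
theorem sgd_trajectory_immersion
    (m n : ℕ) (G : Matrix (Fin m) (Fin n) ℝ) (M : Matrix (Fin n) (Fin m) ℝ)
    (hMG : M * G = 1) (b : Fin m → ℝ) (hMb : M.mulVec b = 0)
    (g : ℕ → (Fin n → ℝ) → (Fin n → ℝ)) (η : ℝ)
    (w : ℕ → Fin n → ℝ) (wt : ℕ → Fin m → ℝ)
    (hw : ∀ k, w (k + 1) = w k - η • g k (w k))
    (hwt : ∀ k, wt (k + 1) = wt k - η • G.mulVec (g k (M.mulVec (wt k))))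
    (h0 : wt 0 = G.mulVec (w 0) + b) :
    ∀ k, wt k = G.mulVec (w k) + b := by
  intro k
  induction k with
  | zero => exact h0
  | succ k ih =>
    have hM : M.mulVec (wt k) = w k := by
      rw [ih, Matrix.mulVec_add, Matrix.mulVec_mulVec, hMG, Matrix.one_mulVec, hMb, add_zero]
    rw [hwt, hM, ih, hw, Matrix.mulVec_sub, Matrix.mulVec_smul]
    abel
end

section
/- Let G be an m×n real matrix whose associated linear map is injective, M an n×m real matrix, and b ∈ ℝ^m. Suppose that for every function g : ℝ^n → ℝ^n and every w ∈ ℝ^n one has G·(g(M·(G·w + b))) = G·(g(w)). Then M·G = I_n and M·b = 0. (Necessity of the design conditions on M and b in the immersion condition.) -/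
/-- necessity of the design conditions `M·G = I` and `M·b = 0`
in the immersion condition. -/
theorem immersion_condition_necessity
    (m n : ℕ) (G : Matrix (Fin m) (Fin n) ℝ)
    (hG : Function.Injective G.mulVec)
    (M : Matrix (Fin n) (Fin m) ℝ) (b : Fin m → ℝ)
    (h : ∀ (g : (Fin n → ℝ) → (Fin n → ℝ)) (w : Fin n → ℝ),
      G.mulVec (g (M.mulVec (G.mulVec w + b))) = G.mulVec (g w)) :
    M * G = 1 ∧ M.mulVec b = 0 := by
  have key : ∀ w, M.mulVec (G.mulVec w + b) = w := fun w => hG (h id w)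
  have hb : M.mulVec b = 0 := by simpa using key 0
  refine ⟨Matrix.ext_of_mulVec_single fun i => ?_, hb⟩
  rw [← Matrix.mulVec_mulVec, Matrix.one_mulVec]
  simpa only [Matrix.mulVec_add, hb, add_zero] using key (Pi.single i 1)
end

section
/- Let G be an m×n real matrix whose associated linear map is injective, M an n×m real matrix with M·G = I_n, and b ∈ ℝ^m with M·b = 0. Let g : ℝ^n → ℝ^n, let η be a nonzero real number, and define f : ℝ^m → ℝ^m by f(x) = x − η·G·(g(M·x)). Then for every w* ∈ ℝ^n: g(w*) = 0 if and only if G·w* + b is a fixed point of f. (The target SGD's equilibria are exactly the encryptions of the standard SGD's stationary points.) -/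
/-- the target SGD's equilibria are exactly the encryptions of
the standard SGD's stationary points. -/
theorem target_fixed_points_iff_stationary
    (m n : ℕ) (G : Matrix (Fin m) (Fin n) ℝ)
    (hG : Function.Injective G.mulVec)
    (M : Matrix (Fin n) (Fin m) ℝ) (hMG : M * G = 1)
    (b : Fin m → ℝ) (hMb : M.mulVec b = 0)
    (g : (Fin n → ℝ) → (Fin n → ℝ)) (η : ℝ) (hη : η ≠ 0)
    (f : (Fin m → ℝ) → (Fin m → ℝ))
    (hf : ∀ x, f x = x - η • G.mulVec (g (M.mulVec x))) :
    ∀ wstar : Fin n → ℝ,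
      g wstar = 0 ↔ f (G.mulVec wstar + b) = G.mulVec wstar + b := by
  intro w
  have hM : M.mulVec (G.mulVec w + b) = w := by
    rw [Matrix.mulVec_add, hMb, Matrix.mulVec_mulVec, hMG, Matrix.one_mulVec, add_zero]
  rw [hf, hM, sub_eq_self, smul_eq_zero_iff_right hη]
  exact ⟨fun h => by rw [h, Matrix.mulVec_zero],
    fun h => hG (by rw [h, Matrix.mulVec_zero])⟩
end

section
/- Let G be an m×n real matrix, M an n×m real matrix with M·G = I_n, and b ∈ ℝ^m with M·b = 0. For each k ∈ ℕ let g_k : ℝ^n → ℝ^n, let η ∈ ℝ, and define sequences w_{k+1} = w_k − η·g_k(w_k) in ℝ^n and w̃_{k+1} = w̃_k − η·G·(g_k(M·w̃_k)) in ℝ^m with w̃_0 = G·w_0 + b. If w_k converges to some w* ∈ ℝ^n as k → ∞, then w̃_k converges to G·w* + b, and M·w̃_k converges to w*. (The target SGD converges to the encrypted version of the standard SGD's limit, and its decryption converges to the standard limit.) -/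
/-- the target SGD converges to the encrypted version of the
standard SGD's limit, and its decryption converges to the standard limit. -/
theorem target_sgd_convergence
    (m n : ℕ) (G : Matrix (Fin m) (Fin n) ℝ) (M : Matrix (Fin n) (Fin m) ℝ)
    (hMG : M * G = 1) (b : Fin m → ℝ) (hMb : M.mulVec b = 0)
    (g : ℕ → (Fin n → ℝ) → (Fin n → ℝ)) (η : ℝ)
    (w : ℕ → Fin n → ℝ) (wt : ℕ → Fin m → ℝ)
    (hw : ∀ k, w (k + 1) = w k - η • g k (w k))
    (hwt : ∀ k, wt (k + 1) = wt k - η • G.mulVec (g k (M.mulVec (wt k))))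
    (h0 : wt 0 = G.mulVec (w 0) + b)
    (wstar : Fin n → ℝ)
    (hconv : Filter.Tendsto w Filter.atTop (nhds wstar)) :
    Filter.Tendsto wt Filter.atTop (nhds (G.mulVec wstar + b)) ∧
      Filter.Tendsto (fun k => M.mulVec (wt k)) Filter.atTop (nhds wstar) := by
  have hdec (s : Fin n → ℝ) : M.mulVec (G.mulVec s + b) = s := by
    rw [Matrix.mulVec_add, hMb, add_zero, Matrix.mulVec_mulVec, hMG, Matrix.one_mulVec]
  have henc (k : ℕ) : wt k = G.mulVec (w k) + b := by
    induction k with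
    | zero => exact h0
    | succ k ih =>
      rw [hwt, ih, hdec, hw, Matrix.mulVec_sub, Matrix.mulVec_smul]
      abel
  have hcont : Continuous fun s : Fin n → ℝ => G.mulVec s + b := by fun_prop
  simp only [funext henc, hdec]
  exact ⟨(hcont.tendsto wstar).comp hconv, hconv⟩
end

section
/- Let G be an m×n real matrix, M an n×m real matrix with M·G = I_n, and let (b^t)_{t∈ℕ} be a sequence in ℝ^m with M·b^t = 0 for all t. Let N_c, K ∈ ℕ, let a_1, …, a_{N_c} be real weights with Σ_{i=1}^{N_c} a_i = 1, let η ∈ ℝ, and for each client i, global round t, and local iteration k let g_{i,t,k} : ℝ^n → ℝ^n be any function. Define the standard FL iteration: from global model w^t ∈ ℝ^n, each client sets w_{i,0} = w^t, iterates w_{i,k+1} = w_{i,k} − η·g_{i,t,k}(w_{i,k}) for k = 0, …, K−1, and the next global model is w^{t+1} = Σ_{i=1}^{N_c} a_i·w_{i,K}. Define the SIFL iteration: from encrypted global model w̃^t ∈ ℝ^m, each client sets w̃_{i,0} = w̃^t, iterates w̃_{i,k+1} = w̃_{i,k} − η·G·(g_{i,t,k}(M·w̃_{i,k})) for k = 0,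 …, K−1, the aggregator computes w̃_{agg}^{t+1} = Σ_{i=1}^{N_c} a_i·w̃_{i,K}, and the server sets the next encrypted global model to w̃^{t+1} = G·(M·w̃_{agg}^{t+1}) + b^{t+1}. If w̃^0 = G·w^0 + b^0, then for every global round t ∈ ℕ: w̃^t = G·w^t + b^t and M·w̃^t = w^t. In particular, the decrypted SIFL global model coincides with the standard FL global model at every round. -/
/-- the decrypted SIFL global model coincides with the standard
FL global model at every round. -/
theorem sifl_global_model_equivalence
    (m n : ℕ) (G : Matrix (Fin m) (Fin n) ℝ) (M : Matrix (Fin n) (Fin m) ℝ)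
    (hMG : M * G = 1)
    (b : ℕ → Fin m → ℝ) (hMb : ∀ t, M.mulVec (b t) = 0)
    (Nc K : ℕ) (a : Fin Nc → ℝ) (ha : ∑ i, a i = 1) (η : ℝ)
    (g : Fin Nc → ℕ → ℕ → (Fin n → ℝ) → (Fin n → ℝ))
    -- standard FL: global models `w`, local iterates `wl t i k`
    (w : ℕ → Fin n → ℝ) (wl : ℕ → Fin Nc → ℕ → Fin n → ℝ)
    (hwl0 : ∀ t i, wl t i 0 = w t)
    (hwl : ∀ t i k, k < K → wl t i (k + 1) = wl t i k - η • g i t k (wl t i k))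
    (hwagg : ∀ t, w (t + 1) = ∑ i, a i • wl t i K)
    -- SIFL: encrypted global models `wt`, encrypted local iterates `wtl t i k`
    (wt : ℕ → Fin m → ℝ) (wtl : ℕ → Fin Nc → ℕ → Fin m → ℝ)
    (hwtl0 : ∀ t i, wtl t i 0 = wt t)
    (hwtl : ∀ t i k, k < K →
      wtl t i (k + 1) = wtl t i k - η • G.mulVec (g i t k (M.mulVec (wtl t i k))))
    (hwtagg : ∀ t,
      wt (t + 1) = G.mulVec (M.mulVec (∑ i, a i • wtl t i K)) + b (t + 1))
    (h0 : wt 0 = G.mulVec (w 0) + b 0) :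
    ∀ t, wt t = G.mulVec (w t) + b t ∧ M.mulVec (wt t) = w t := by
  have decrypt : ∀ v : Fin n → ℝ, M.mulVec (G.mulVec v) = v := fun v => by
    rw [Matrix.mulVec_mulVec, hMG, Matrix.one_mulVec]
  have decrypt_immersion : ∀ t (v : Fin n → ℝ), M.mulVec (G.mulVec v + b t) = v := fun t v => by
    rw [Matrix.mulVec_add, decrypt, hMb, add_zero]
  have immersed : ∀ t, wt t = G.mulVec (w t) + b t := by
    intro t
    induction t with
    | zero => exact h0
    | succ t ih =>
      have hlocal : ∀ i k, k ≤ K → M.mulVec (wtl t i k) = wl t i k := by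
        intro i k
        induction k with
        | zero => intro _; rw [hwtl0, hwl0, ih, decrypt_immersion]
        | succ k ihk =>
          intro hk
          rw [hwtl t i k hk, hwl t i k hk, Matrix.mulVec_sub, Matrix.mulVec_smul, decrypt,
            ihk (Nat.le_of_succ_le hk)]
      have hagg : M.mulVec (∑ i, a i • wtl t i K) = ∑ i, a i • wl t i K := by
        simp only [Matrix.mulVec_sum, Matrix.mulVec_smul, hlocal _ K le_rfl]
      rw [hwtagg, hwagg, hagg]
  exact fun t => ⟨immersed t, by rw [immersed t, decrypt_immersion]⟩
end

section
/- Let G be an m×n real matrix, M an n×m real matrix with M·G = I_n, and b ∈ ℝ^m with M·b = 0. For each k ∈ ℕ let g_k : ℝ^n → ℝ^n, let η ∈ ℝ, and define sequences w_{k+1} = w_k − η·g_k(w_k) in ℝ^n and w̃_{k+1} = w̃_k − η·G·(g_k(M·w̃_k)) in ℝ^m with w̃_0 = G·w_0 + b. Then for every function L : ℝ^n → ℝ and every k ∈ ℕ, L(M·w̃_k) = L(w_k); in particular, any loss function evaluated at the decrypted target SGD iterate equals the loss at the corresponding standard SGD iterate, so encryption incurs no loss of training accuracy. -/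
/-- any loss function evaluated at the decrypted target SGD
iterate equals the loss at the corresponding standard SGD iterate. -/
theorem loss_preserved_under_encryption
    (m n : ℕ) (G : Matrix (Fin m) (Fin n) ℝ) (M : Matrix (Fin n) (Fin m) ℝ)
    (hMG : M * G = 1) (b : Fin m → ℝ) (hMb : M.mulVec b = 0)
    (g : ℕ → (Fin n → ℝ) → (Fin n → ℝ)) (η : ℝ)
    (w : ℕ → Fin n → ℝ) (wt : ℕ → Fin m → ℝ)
    (hw : ∀ k, w (k + 1) = w k - η • g k (w k))
    (hwt : ∀ k, wt (k + 1) = wt k - η • G.mulVec (g k (M.mulVec (wt k))))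
    (h0 : wt 0 = G.mulVec (w 0) + b) :
    ∀ (L : (Fin n → ℝ) → ℝ) (k : ℕ), L (M.mulVec (wt k)) = L (w k) := by
  intro L k
  have decrypt_eq : M.mulVec (wt k) = w k := by
    induction k with
    | zero =>
      rw [h0, Matrix.mulVec_add, Matrix.mulVec_mulVec, hMG, Matrix.one_mulVec, hMb, add_zero]
    | succ k ih =>
      rw [hwt, hw, Matrix.mulVec_sub, Matrix.mulVec_smul, Matrix.mulVec_mulVec, hMG,
        Matrix.one_mulVec, ih]
  rw [decrypt_eq]
end
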